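/- Fix n ≥ 2 and consider n qubits with the complete-graph Quantum Max Cut Hamiltonian Σ_{1 ≤ i < j ≤ n} H_{ij}. Then the sum-of-squares matrix identity holds: Σ_{i=1}^n (√((n+2)/8)·I − √(2/(n+2))·Σ_{j ≠ i} H_{ij})² = (n(n+2)/8)·I − Σ_{1 ≤ i < j ≤ n} H_{ij}. In particular (n(n+2)/8)·I − Σ_{i<j} H_{ij} is positive semidefinite, so λ_max(Σ_{i<j} H_{ij}) ≤ n(n+2)/8. -/

import Mathlib

open Matrix Finset
open scoped ComplexOrder

noncomputable section

/-- The SWAP matrix on qubits indexed by `V`, exchanging tensor factors `i` and `j`. -/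
def swapMat {V : Type*} [Fintype V] [DecidableEq V] (i j : V) :
    Matrix (V → Fin 2) (V → Fin 2) ℂ :=
  Matrix.of fun f g => if f ∘ (Equiv.swap i j) = g then 1 else 0

/-- The singlet projector `H_{ij} = (I - P_{ij})/2`. -/
def singletProj {V : Type*} [Fintype V] [DecidableEq V] (i j : V) :
    Matrix (V → Fin 2) (V → Fin 2) ℂ :=
  (2 : ℂ)⁻¹ • (1 - swapMat i j)

theorem comp_swap_of_eq {V α : Type*} [DecidableEq V] {f : V → α} {i j : V} (h : f i = f j) :
    f ∘ Equiv.swap i j = f := by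
  funext x
  simp only [Function.comp_apply, Equiv.swap_apply_def]
  grind

section

variable {V : Type*} [Fintype V] [DecidableEq V]

theorem swapMat_apply (i j : V) (f g : V → Fin 2) :
    swapMat i j f g = if f ∘ Equiv.swap i j = g then 1 else 0 := rfl

theorem swapMat_mul_apply (i j : V) (M : Matrix (V → Fin 2) (V → Fin 2) ℂ) (f g : V → Fin 2) :
    (swapMat i j * M) f g = M (f ∘ Equiv.swap i j) g := by
  simp [Matrix.mul_apply, swapMat_apply]

theorem swapMat_self (i : V) : swapMat i i = 1 := by
  ext f g
  simp [swapMat_apply, Matrix.one_apply]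

theorem swapMat_comm (i j : V) : swapMat i j = swapMat j i := by
  ext f g
  simp [swapMat_apply, Equiv.swap_comm i j]

theorem swapMat_mul_self (i j : V) : swapMat i j * swapMat i j = 1 := by
  ext f g
  simp [swapMat_mul_apply, swapMat_apply, Matrix.one_apply, Function.comp_assoc, ← Equiv.coe_trans]

theorem swapMat_isHermitian (i j : V) : (swapMat i j).IsHermitian := by
  ext f g
  have h : g ∘ Equiv.swap i j = f ↔ f ∘ Equiv.swap i j = g := by
    constructor <;> rintro rfl <;> funext x <;> simp
  simp [swapMat_apply, h, apply_ite]

/-- The antisymmetrizer on three qubits vanishes. -/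
theorem swapMat_mul_add_mul {i j k : V} (hij : i ≠ j) (hik : i ≠ k) (hjk : j ≠ k) :
    swapMat i j * swapMat i k + swapMat i k * swapMat i j
      = swapMat i j + swapMat i k + swapMat j k - 1 := by
  ext f g
  simp only [Matrix.add_apply, Matrix.sub_apply, swapMat_mul_apply, Matrix.one_apply]
  simp only [swapMat_apply]
  have h : f i = f j ∨ f i = f k ∨ f j = f k := by omega
  rcases h with h | h | h
  · have h₁ := comp_swap_of_eq h
    have h₂ : (f ∘ Equiv.swap i k) ∘ Equiv.swap i j = f ∘ Equiv.swap j k := by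
      funext x
      simp only [Function.comp_apply, Equiv.swap_apply_def]
      grind
    rw [h₁, h₂]
    ring
  · have h₁ := comp_swap_of_eq h
    have h₂ : (f ∘ Equiv.swap i j) ∘ Equiv.swap i k = f ∘ Equiv.swap j k := by
      funext x
      simp only [Function.comp_apply, Equiv.swap_apply_def]
      grind
    rw [h₁, h₂]
    ring
  · have h₁ := comp_swap_of_eq h
    have h₂ : (f ∘ Equiv.swap i j) ∘ Equiv.swap i k = f ∘ Equiv.swap i j := by
      funext x
      simp only [Function.comp_apply, Equiv.swap_apply_def]
      grind
    have h₃ : (f ∘ Equiv.swap i k) ∘ Equiv.swap i j = f ∘ Equiv.swap i k := by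
      funext x
      simp only [Function.comp_apply, Equiv.swap_apply_def]
      grind
    rw [h₁, h₂, h₃]
    ring

theorem singletProj_self (i : V) : singletProj i i = 0 := by
  simp [singletProj, swapMat_self]

theorem singletProj_comm (i j : V) : singletProj i j = singletProj j i := by
  rw [singletProj, singletProj, swapMat_comm]

theorem singletProj_isHermitian (i j : V) : (singletProj i j).IsHermitian := by
  rw [Matrix.IsHermitian, singletProj, Matrix.conjTranspose_smul, Matrix.conjTranspose_sub,
    Matrix.conjTranspose_one, (swapMat_isHermitian i j).eq]
  simp

theorem singletProj_mul_self (i j : V) : singletProj i j * singletProj i j = singletProj i j := by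
  simp only [singletProj, smul_mul_smul_comm, sub_mul, mul_sub, swapMat_mul_self, one_mul, mul_one]
  module

theorem singletProj_mul_add_mul (i j k : V) :
    singletProj i j * singletProj i k + singletProj i k * singletProj i j
      = (2 : ℂ)⁻¹ • (singletProj i j + singletProj i k - singletProj j k)
        + if j = k then singletProj i j else 0 := by
  rcases eq_or_ne j k with rfl | hjk
  · simp only [singletProj_mul_self, singletProj_self, if_true]
    module
  rcases eq_or_ne i j with rfl | hij
  · simp [singletProj_self, hjk]
  rcases eq_or_ne i k with rfl | hik
  · simp [singletProj_self, hjk, singletProj_comm i j]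
  have h := swapMat_mul_add_mul hij hik hjk
  simp only [singletProj, smul_mul_smul_comm, hjk, if_false, add_zero]
  generalize swapMat i j = A, swapMat i k = B, swapMat j k = C at h ⊢
  rw [← smul_add, show (1 - A) * (1 - B) + (1 - B) * (1 - A)
    = (1 - A - B) + (1 - A - B) + (A * B + B * A) by
      simp only [sub_mul, mul_sub, one_mul, mul_one]; abel, h,
    show (1 - A - B) + (1 - A - B) + (A + B + C - 1) = 1 - A - B + C by abel]
  module

theorem sum_sq_sum_singletProj :
    ∑ i : V, (∑ j, singletProj i j) * ∑ j, singletProj i j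
      = (((Fintype.card V : ℂ) + 2) / 4) • ∑ i : V, ∑ j, singletProj i j := by
  have h : ∑ i : V, ∑ j, ∑ k,
      (singletProj i j * singletProj i k + singletProj i k * singletProj i j)
      = 2 • ∑ i : V, (∑ j, singletProj i j) * ∑ j, singletProj i j := by
    rw [two_smul]
    simp only [sum_add_distrib, sum_mul_sum]
    refine congrArg _ (sum_congr rfl fun i _ => ?_)
    rw [sum_comm]
  have h' : ∑ i : V, ∑ j, ∑ k, singletProj j k
      = (Fintype.card V : ℂ) • ∑ i : V, ∑ j, singletProj i j := by
    simp [Nat.cast_smul_eq_nsmul]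
  have h₁ : ∑ i : V, ∑ j : V, ∑ _k : V, singletProj i j
      = (Fintype.card V : ℂ) • ∑ i : V, ∑ j, singletProj i j := by
    simp [Nat.cast_smul_eq_nsmul, smul_sum]
  have h₂ : ∑ i : V, ∑ _j : V, ∑ k : V, singletProj i k
      = (Fintype.card V : ℂ) • ∑ i : V, ∑ j, singletProj i j := by
    simp [Nat.cast_smul_eq_nsmul, smul_sum]
  simp only [singletProj_mul_add_mul, sum_add_distrib, sum_sub_distrib, ← smul_sum, h', h₁, h₂,
    sum_ite_eq, mem_univ, if_true] at h
  rw [← Nat.cast_smul_eq_nsmul ℂ] at h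
  have h2 := congrArg ((2 : ℂ)⁻¹ • ·) h
  simp only [smul_smul] at h2
  norm_num at h2
  rw [← h2]
  module

theorem sum_erase_singletProj (i : V) :
    ∑ j ∈ univ.erase i, singletProj i j = ∑ j, singletProj i j :=
  sum_erase _ (singletProj_self i)

end

theorem sum_sum_singletProj {V : Type*} [Fintype V] [LinearOrder V] [LocallyFiniteOrderTop V] :
    ∑ i : V, ∑ j, singletProj i j = (2 : ℂ) • ∑ i : V, ∑ j ∈ Ioi i, singletProj i j := by
  have h (i j : V) : singletProj i j
      = (if i < j then singletProj i j else 0) + if j < i then singletProj j i else 0 := by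
    rcases lt_trichotomy i j with h | rfl | h
    · simp [h, h.not_gt]
    · simp [singletProj_self]
    · simp [h, h.not_gt, singletProj_comm]
  have h' (i : V) : ∑ j ∈ Ioi i, singletProj i j = ∑ j, if i < j then singletProj i j else 0 := by
    rw [← sum_filter]
    congr 1
    ext
    simp
  simp only [h']
  rw [sum_congr rfl fun i _ => sum_congr rfl fun j _ => h i j]
  simp only [sum_add_distrib, two_smul]
  congr 1
  exact sum_comm

theorem iSup_eigenvalues_le_of_posSemidef {m : Type*} [Fintype m] [DecidableEq m] [Nonempty m]
    {A : Matrix m m ℂ} (hA : A.IsHermitian) {c : ℝ} (h : ((c : ℂ) • 1 - A).PosSemidef) :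
    ⨆ y, hA.eigenvalues y ≤ c := by
  refine ciSup_le fun y => ?_
  have h₁ := h.dotProduct_mulVec_nonneg (hA.eigenvectorBasis y)
  have h₂ : (star ⇑(hA.eigenvectorBasis y)) ⬝ᵥ ⇑(hA.eigenvectorBasis y) = (1 : ℂ) := by
    have := hA.eigenvectorBasis.orthonormal.1 y
    have h₃ := inner_self_eq_norm_sq_to_K (𝕜 := ℂ) (hA.eigenvectorBasis y)
    rw [this, EuclideanSpace.inner_eq_star_dotProduct, dotProduct_comm] at h₃
    simpa using h₃
  rw [Matrix.sub_mulVec, hA.mulVec_eigenvectorBasis, Matrix.smul_mulVec, Matrix.one_mulVec,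
    dotProduct_sub, dotProduct_smul, dotProduct_smul, h₂] at h₁
  simpa [← Complex.ofReal_sub, Complex.real_smul] using h₁

/-- Level-1 sum-of-squares identity for the uniform complete graph on `n` qubits:
`Σᵢ (√((n+2)/8)·I − √(2/(n+2))·Σ_{j≠i} H_{ij})² = (n(n+2)/8)·I − Σ_{i<j} H_{ij}`.
In particular the right-hand side is positive semidefinite, so
`λ_max(Σ_{i<j} H_{ij}) ≤ n(n+2)/8`. -/
theorem stmt13 (n : ℕ) (hn : 2 ≤ n)
    (hH : (∑ i : Fin n, ∑ j ∈ Finset.Ioi i, singletProj i j).IsHermitian) :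
    (∑ i : Fin n,
        ((Real.sqrt (((n : ℝ) + 2) / 8) : ℂ) • (1 : Matrix (Fin n → Fin 2) (Fin n → Fin 2) ℂ)
          - (Real.sqrt (2 / ((n : ℝ) + 2)) : ℂ) •
              ∑ j ∈ Finset.univ.erase i, singletProj i j) ^ 2
      = (((n : ℂ) * ((n : ℂ) + 2)) / 8) • 1
          - ∑ i : Fin n, ∑ j ∈ Finset.Ioi i, singletProj i j) ∧
    ((((n : ℂ) * ((n : ℂ) + 2)) / 8) • (1 : Matrix (Fin n → Fin 2) (Fin n → Fin 2) ℂ)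
      - ∑ i : Fin n, ∑ j ∈ Finset.Ioi i, singletProj i j).PosSemidef ∧
    (⨆ y, hH.eigenvalues y) ≤ (n : ℝ) * ((n : ℝ) + 2) / 8 := by
  have hpos : (0 : ℝ) < n + 2 := by positivity
  have hC : (n : ℂ) + 2 ≠ 0 := by exact_mod_cast hpos.ne'
  have ha : (Real.sqrt (((n : ℝ) + 2) / 8) : ℂ) * Real.sqrt (((n : ℝ) + 2) / 8)
      = ((n : ℂ) + 2) / 8 := by
    rw [← Complex.ofReal_mul, Real.mul_self_sqrt (by positivity)]
    push_cast
    ring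
  have hb : (Real.sqrt (2 / ((n : ℝ) + 2)) : ℂ) * Real.sqrt (2 / ((n : ℝ) + 2))
      = 2 / ((n : ℂ) + 2) := by
    rw [← Complex.ofReal_mul, Real.mul_self_sqrt (by positivity)]
    push_cast
    ring
  have hab : (Real.sqrt (((n : ℝ) + 2) / 8) : ℂ) * Real.sqrt (2 / ((n : ℝ) + 2)) = 1 / 2 := by
    rw [← Complex.ofReal_mul, ← Real.sqrt_mul (by positivity),
      show ((n : ℝ) + 2) / 8 * (2 / (n + 2)) = (1 / 2) ^ 2 by field_simp; norm_num,
      Real.sqrt_sq (by norm_num)]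
    norm_num
  generalize (Real.sqrt (((n : ℝ) + 2) / 8)) = a at *
  generalize (Real.sqrt (2 / ((n : ℝ) + 2))) = b at *
  have hsos : ∑ i : Fin n,
        ((a : ℂ) • (1 : Matrix (Fin n → Fin 2) (Fin n → Fin 2) ℂ)
          - (b : ℂ) • ∑ j ∈ Finset.univ.erase i, singletProj i j) ^ 2
      = (((n : ℂ) * ((n : ℂ) + 2)) / 8) • 1
          - ∑ i : Fin n, ∑ j ∈ Finset.Ioi i, singletProj i j := by
    have hsq (S : Matrix (Fin n → Fin 2) (Fin n → Fin 2) ℂ) :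
        ((a : ℂ) • (1 : Matrix (Fin n → Fin 2) (Fin n → Fin 2) ℂ) - (b : ℂ) • S) ^ 2
          = (((n : ℂ) + 2) / 8) • 1 - S + (2 / ((n : ℂ) + 2)) • (S * S) := by
      rw [← ha, ← hb, sq]
      simp only [sub_mul, mul_sub, smul_mul_smul_comm, one_mul, mul_one, mul_comm (b : ℂ) a, hab]
      module
    simp only [sum_erase_singletProj, hsq, sum_add_distrib, sum_sub_distrib, ← smul_sum,
      sum_sq_sum_singletProj, sum_sum_singletProj, smul_smul, Fintype.card_fin]
    rw [show 2 / ((n : ℂ) + 2) * (((n : ℂ) + 2) / 4 * 2) = 1 by field_simp; norm_num]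
    simp only [sum_const, card_univ, Fintype.card_fin, ← Nat.cast_smul_eq_nsmul ℂ]
    module
  have hpsd : ((((n : ℂ) * ((n : ℂ) + 2)) / 8) • (1 : Matrix (Fin n → Fin 2) (Fin n → Fin 2) ℂ)
      - ∑ i : Fin n, ∑ j ∈ Finset.Ioi i, singletProj i j).PosSemidef := by
    rw [← hsos]
    refine Matrix.posSemidef_sum _ fun i _ => ?_
    have hherm : ((a : ℂ) • (1 : Matrix (Fin n → Fin 2) (Fin n → Fin 2) ℂ)
          - (b : ℂ) • ∑ j ∈ Finset.univ.erase i, singletProj i j).IsHermitian := by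
      simp [Matrix.IsHermitian, Matrix.conjTranspose_sum, (singletProj_isHermitian _ _).eq]
    rw [sq]
    nth_rewrite 1 [← hherm.eq]
    exact Matrix.posSemidef_conjTranspose_mul_self _
  refine ⟨hsos, hpsd, iSup_eigenvalues_le_of_posSemidef hH ?_⟩
  push_cast
  exact hpsd

end
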